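/- Let σ₂ : ℝ → Prop be the signal with σ₂(t) ↔ t ∈ [0,1] \ {1/2}. Then for every t ∈ ℝ, α₁(σ₂)(t) holds if and only if t ∈ (0, 1/2) ∪ (1/2, 1). In particular α₁(σ₁)(1/2) holds while α₁(σ₂)(1/2) fails, where σ₁(t) ↔ t ∈ [0,1]. -/

import Mathlib

/-- The smoothing abstraction on Boolean signals over ℝ: `alpha1 σ t` holds iff
`σ` holds on a whole open interval `(t − δ, t + δ)` around `t` for some `δ > 0`. -/
def alpha1 (σ : ℝ → Prop) (t : ℝ) : Prop :=
  ∃ δ > 0, ∀ t' ∈ Set.Ioo (t - δ) (t + δ), σ t'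

/-- **α₁ of the punctured indicator.** For `σ₂(t) ↔ t ∈ [0,1] \ {1/2}`,
`α₁(σ₂)(t)` holds iff `t ∈ (0,1/2) ∪ (1/2,1)`; in particular `α₁(σ₁)(1/2)`
holds while `α₁(σ₂)(1/2)` fails, where `σ₁(t) ↔ t ∈ [0,1]`. -/
theorem alpha1_punctured_indicator :
    (∀ t : ℝ, alpha1 (fun s => s ∈ Set.Icc (0 : ℝ) 1 \ {(1 : ℝ) / 2}) t ↔
        t ∈ Set.Ioo (0 : ℝ) ((1 : ℝ) / 2) ∪ Set.Ioo ((1 : ℝ) / 2) 1) ∧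
      alpha1 (fun s => s ∈ Set.Icc (0 : ℝ) 1) ((1 : ℝ) / 2) ∧
      ¬ alpha1 (fun s => s ∈ Set.Icc (0 : ℝ) 1 \ {(1 : ℝ) / 2}) ((1 : ℝ) / 2) := by
  have key : ∀ t : ℝ, alpha1 (fun s => s ∈ Set.Icc (0 : ℝ) 1 \ {(1 : ℝ) / 2}) t ↔
      t ∈ Set.Ioo (0 : ℝ) ((1 : ℝ) / 2) ∪ Set.Ioo ((1 : ℝ) / 2) 1 := by
    intro t
    constructor
    · rintro ⟨δ, hδ, h⟩
      have h0 := h t ⟨by linarith, by linarith⟩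
      have h1 := h (t - δ / 2) ⟨by linarith, by linarith⟩
      have h2 := h (t + δ / 2) ⟨by linarith, by linarith⟩
      have hne : t ≠ 1 / 2 := h0.2
      have a := h1.1.1
      have b := h2.1.2
      rcases lt_or_gt_of_ne hne with hlt | hgt
      · exact Or.inl ⟨by linarith, hlt⟩
      · exact Or.inr ⟨hgt, by linarith⟩
    · rintro (⟨h0, h1⟩ | ⟨h0, h1⟩)
      · refine ⟨min t (1 / 2 - t), lt_min h0 (by linarith), ?_⟩
        rintro s ⟨ha, hb⟩
        have m1 := min_le_left t (1 / 2 - t)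
        have m2 := min_le_right t (1 / 2 - t)
        have hs : s < 1 / 2 := by linarith
        exact ⟨⟨by linarith, by linarith⟩, hs.ne⟩
      · refine ⟨min (t - 1 / 2) (1 - t), lt_min (by linarith) (by linarith), ?_⟩
        rintro s ⟨ha, hb⟩
        have m1 := min_le_left (t - 1 / 2) (1 - t)
        have m2 := min_le_right (t - 1 / 2) (1 - t)
        have hs : 1 / 2 < s := by linarith
        exact ⟨⟨by linarith, by linarith⟩, hs.ne'⟩
  refine ⟨key, ⟨1 / 2, by norm_num, ?_⟩, ?_⟩
  · rintro s ⟨ha, hb⟩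
    exact ⟨by linarith, by linarith⟩
  · rw [key]
    rintro (⟨_, h⟩ | ⟨h, _⟩) <;> exact lt_irrefl _ h
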